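/- Let n ∈ ℕ, n ≥ 1, let w : [a, b] → [0, ∞) be an integrable weight function, let x₁ < … < x_n be points of the open interval (a, b), and let w₁, …, w_n ∈ ℝ be such that Σ_{i=1}^n wᵢ p(xᵢ) = ∫ₐᵇ p(x) w(x) dx for every polynomial p ∈ Π_{2n−1} (a Gauss-type quadrature rule). Then for every (2n−1)-convex function f : [a, b] → ℝ (any such f is Riemann integrable on [a, b]) one has Σ_{i=1}^n wᵢ f(xᵢ) ≤ ∫ₐᵇ f(x) w(x) dx. -/

import Mathlib

/-- Divided differences of `f` at the points of a list, defined recursively: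
`[x₁; f] = f x₁` and
`[x₁, …, x_{k+1}; f] = ([x₂, …, x_{k+1}; f] − [x₁, …, x_k; f]) / (x_{k+1} − x₁)`. -/
noncomputable def divDiff (f : ℝ → ℝ) : List ℝ → ℝ
  | [] => 0
  | [x] => f x
  | x :: y :: l =>
      (divDiff f (y :: l) - divDiff f (x :: (y :: l).dropLast)) /
        ((y :: l).getLast (List.cons_ne_nil y l) - x)
termination_by l => l.length
decreasing_by
  all_goals simp [List.length_dropLast]

/-- A function `f` is `n`-convex on a set `I` if all its `(n+2)`-point divided
differences at distinct points of `I` are nonnegative. -/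
def NConvexOn (n : ℕ) (I : Set ℝ) (f : ℝ → ℝ) : Prop :=
  ∀ l : List ℝ, l.length = n + 2 → l.Nodup → (∀ x ∈ l, x ∈ I) → 0 ≤ divDiff f l

section FinsetDivDiff

open Finset

/-- The divided difference of `f` over a finite set of points, as an explicit sum. -/
noncomputable def finsetDivDiff (f : ℝ → ℝ) (S : Finset ℝ) : ℝ :=
  ∑ i ∈ S, f i * ∏ j ∈ S.erase i, (i - j)⁻¹

theorem finsetDivDiff_singleton (f : ℝ → ℝ) (x : ℝ) : finsetDivDiff f {x} = f x := by
  simp [finsetDivDiff]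

theorem finsetDivDiff_insert (f : ℝ → ℝ) {S : Finset ℝ} {t : ℝ} (ht : t ∉ S) :
    finsetDivDiff f (insert t S) = f t * ∏ j ∈ S, (t - j)⁻¹ +
      ∑ i ∈ S, f i * (∏ j ∈ S.erase i, (i - j)⁻¹) * (i - t)⁻¹ := by
  rw [finsetDivDiff, sum_insert ht, erase_insert ht]
  congr 1
  refine sum_congr rfl fun i hi => ?_
  have hit : t ≠ i := fun h => ht (h ▸ hi)
  rw [erase_insert_of_ne hit, prod_insert (fun h => ht (mem_of_mem_erase h))]
  ring

theorem finsetDivDiff_insert_sub_insert (f : ℝ → ℝ) {R : Finset ℝ} {x y : ℝ}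
    (hx : x ∉ R) (hy : y ∉ R) (hxy : x ≠ y) :
    finsetDivDiff f (insert y R) - finsetDivDiff f (insert x R) =
      (y - x) * finsetDivDiff f (insert x (insert y R)) := by
  have hx' : x ∉ insert y R := by simp [hx, hxy]
  have hxy0 : x - y ≠ 0 := sub_ne_zero.2 hxy
  have hyx0 : y - x ≠ 0 := sub_ne_zero.2 hxy.symm
  rw [finsetDivDiff_insert f hx', finsetDivDiff_insert f hx, finsetDivDiff_insert f hy,
    prod_insert hy, sum_insert hy, erase_insert hy]
  have key : ∑ i ∈ R, f i * (∏ j ∈ R.erase i, (i - j)⁻¹) * (i - y)⁻¹ -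
      ∑ i ∈ R, f i * (∏ j ∈ R.erase i, (i - j)⁻¹) * (i - x)⁻¹ =
      (y - x) * ∑ i ∈ R, f i * (∏ j ∈ (insert y R).erase i, (i - j)⁻¹) * (i - x)⁻¹ := by
    rw [← sum_sub_distrib, mul_sum]
    refine sum_congr rfl fun i hi => ?_
    have hiy : y ≠ i := fun h => hy (h ▸ hi)
    have hix : x ≠ i := fun h => hx (h ▸ hi)
    rw [erase_insert_of_ne hiy, prod_insert (fun h => hy (mem_of_mem_erase h))]
    have h1 : i - y ≠ 0 := sub_ne_zero.2 hiy.symm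
    have h2 : i - x ≠ 0 := sub_ne_zero.2 hix.symm
    field_simp
    ring
  have e1 : (y - x) * (y - x)⁻¹ = 1 := mul_inv_cancel₀ hyx0
  have e2 : (y - x) * (x - y)⁻¹ = -1 := by rw [← neg_sub x y]; field_simp
  linear_combination key - f y * (∏ j ∈ R, (y - j)⁻¹) * e1 - f x * (∏ j ∈ R, (x - j)⁻¹) * e2

theorem divDiff_cons_concat (f : ℝ → ℝ) (x z : ℝ) (l : List ℝ) :
    divDiff f (x :: (l ++ [z])) =
      (divDiff f (l ++ [z]) - divDiff f (x :: l)) / (z - x) := by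
  cases l with
  | nil => simp [divDiff]
  | cons y l =>
    rw [List.cons_append, divDiff]
    simp only [← List.cons_append, List.dropLast_concat, List.getLast_append_singleton]

theorem divDiff_eq_finsetDivDiff (f : ℝ → ℝ) (l : List ℝ) (hl : l.Nodup) :
    divDiff f l = finsetDivDiff f l.toFinset := by
  induction h : l.length using Nat.strong_induction_on generalizing l with
  | _ k ih =>
    subst h
    match l with
    | [] => simp [divDiff, finsetDivDiff]
    | [x] => simp [divDiff, finsetDivDiff_singleton]
    | x :: y :: l =>
      obtain ⟨m, z, hm⟩ : ∃ m z, y :: l = m ++ [z] :=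
        ⟨_, _, (List.dropLast_append_getLast (List.cons_ne_nil y l)).symm⟩
      rw [hm] at hl ih ⊢
      have hd := List.nodup_cons.1 hl
      have hm' : m.Nodup := hd.2.of_append_left
      have hxm : x ∉ m := fun h => hd.1 (by simp [h])
      have hxz : x ≠ z := fun h => hd.1 (by simp [h])
      have hzm : z ∉ m := fun h => by
        have := List.nodup_append.1 hd.2
        exact this.2.2 z h z (by simp) rfl
      have hset : (m ++ [z]).toFinset = insert z m.toFinset := by ext; simp
      rw [divDiff_cons_concat, ih _ (by simp) _ hd.2 rfl,
        ih _ (by simp) (x :: m) (List.nodup_cons.2 ⟨hxm, hm'⟩) rfl, List.toFinset_cons,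
        List.toFinset_cons, hset,
        finsetDivDiff_insert_sub_insert f (by simpa) (by simpa) hxz,
        mul_div_cancel_left₀ _ (sub_ne_zero.2 hxz.symm)]

theorem NConvexOn.finsetDivDiff_nonneg {n : ℕ} {I : Set ℝ} {f : ℝ → ℝ} (hf : NConvexOn n I f)
    {S : Finset ℝ} (hS : S.card = n + 2) (hSI : ↑S ⊆ I) : 0 ≤ finsetDivDiff f S := by
  have := hf S.toList (by simpa) S.nodup_toList (fun x hx => hSI (by simpa using hx))
  rwa [divDiff_eq_finsetDivDiff f _ S.nodup_toList, toList_toFinset] at this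

/-- The error formula for Lagrange interpolation. -/
theorem sub_eval_interpolate (f : ℝ → ℝ) {S : Finset ℝ} {t : ℝ} (ht : t ∉ S) :
    f t - (Lagrange.interpolate S id f).eval t =
      finsetDivDiff f (insert t S) * ∏ y ∈ S, (t - y) := by
  have hne : ∏ y ∈ S, (t - y) ≠ 0 :=
    prod_ne_zero_iff.2 fun y hy => sub_ne_zero.2 fun h => ht (h ▸ hy)
  rw [finsetDivDiff_insert f ht, Lagrange.eval_interpolate_not_at_node f
    (fun i hi h => ht (by simpa [h] using hi)), Lagrange.eval_nodal, prod_inv_distrib, add_mul,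
    mul_assoc, inv_mul_cancel₀ hne, mul_one, sub_eq_add_neg, ← mul_neg, ← sum_neg_distrib,
    mul_comm (∑ i ∈ S, _)]
  congr 2
  refine sum_congr rfl fun i _ => ?_
  rw [Lagrange.nodalWeight, ← neg_sub t i, inv_neg]
  simp only [id]
  ring

/-- The Newton step for Lagrange interpolation. -/
theorem eval_interpolate_insert (f : ℝ → ℝ) {S : Finset ℝ} {y : ℝ} (hy : y ∉ S) (t : ℝ) :
    (Lagrange.interpolate (insert y S) id f).eval t =
      (Lagrange.interpolate S id f).eval t +
        finsetDivDiff f (insert y S) * ∏ z ∈ S, (t - z) := by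
  have hn : ∀ {T : Finset ℝ} {s : ℝ}, s ∈ T → (Lagrange.interpolate T id f).eval s = f s :=
    fun hs => Lagrange.eval_interpolate_at_node f (Function.injective_id.injOn) hs
  by_cases hty : t = y
  · subst hty
    rw [hn (mem_insert_self _ _), ← sub_eval_interpolate f hy]
    ring
  by_cases htS : t ∈ S
  · rw [hn htS, hn (mem_insert_of_mem htS), prod_eq_zero htS (sub_self t)]
    ring
  have h1 := sub_eval_interpolate f (S := insert y S) (t := t) (by simp [hty, htS])
  have h2 := sub_eval_interpolate f htS
  have h3 := finsetDivDiff_insert_sub_insert f htS hy hty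
  rw [prod_insert hy] at h1
  linear_combination h2 - h1 - (∏ z ∈ S, (t - z)) * h3

theorem le_finsetDivDiff_union_sub_union (f : ℝ → ℝ) {k j : ℕ} {lo : ℝ} {A S T : Finset ℝ}
    (hS : S.card = j) (hT : T.card = j) (hA : A.card + j = k) (hAS : Disjoint A S)
    (hAT : Disjoint A T) (hST : Disjoint S T)
    (h : ∀ s ∈ S, ∀ t ∈ T, ∀ U ⊆ A ∪ S ∪ T, U.card = k + 1 →
      lo ≤ (t - s) * finsetDivDiff f U) :
    j * lo ≤ finsetDivDiff f (A ∪ T) - finsetDivDiff f (A ∪ S) := by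
  induction j generalizing A S T with
  | zero =>
    rw [card_eq_zero] at hS hT
    simp [hS, hT]
  | succ j ih =>
    obtain ⟨s, S', hs, rfl, hS'⟩ := card_eq_succ.1 hS
    obtain ⟨t, T', ht, rfl, hT'⟩ := card_eq_succ.1 hT
    simp only [disjoint_insert_left, disjoint_insert_right, mem_insert, not_or] at hAS hAT hST
    obtain ⟨hsA, hAS⟩ := hAS
    obtain ⟨htA, hAT⟩ := hAT
    obtain ⟨⟨hst, htS⟩, hsT, hST⟩ := hST
    have h1 := ih (A := insert t A) hS' hT' (by rw [card_insert_of_notMem htA]; omega)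
      (by simp [htS, hAS]) (by simp [ht, hAT]) hST
      (fun s' hs' t' ht' U hU hUc => h s' (by simp [hs']) t' (by simp [ht']) U
        (hU.trans (by intro u; simp; tauto)) hUc)
    have h2 := h s (by simp) t (by simp) (insert s (insert t (A ∪ S')))
      (by intro u; simp; tauto)
      (by rw [card_insert_of_notMem (by simp; tauto), card_insert_of_notMem (by simp; tauto),
        card_union_of_disjoint hAS]; omega)
    rw [← finsetDivDiff_insert_sub_insert f (by simp; tauto) (by simp; tauto)
      (fun e => hst e.symm)] at h2
    rw [union_insert, union_insert, ← insert_union]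
    rw [insert_union] at h1 ⊢
    rw [insert_union] at h1
    push_cast
    linarith

theorem exists_abs_finsetDivDiff_le {f : ℝ → ℝ} {a b : ℝ} {m : ℕ}
    (hf : ∀ S : Finset ℝ, ↑S ⊆ Set.Icc a b → S.card = m + 1 → 0 ≤ finsetDivDiff f S)
    {k : ℕ} (hk : k ≤ m) {c d : ℝ} (hac : a < c) (hcd : c < d) (hdb : d < b) :
    ∃ C, ∀ S : Finset ℝ, ↑S ⊆ Set.Icc c d → S.card = k → |finsetDivDiff f S| ≤ C := by
  induction hk using Nat.decreasingInduction generalizing c with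
  | self =>
    obtain ⟨T₁, hT₁, hc₁⟩ := (Set.Ioo_infinite hac).exists_subset_card_eq m
    obtain ⟨T₂, hT₂, hc₂⟩ := (Set.Ioo_infinite hdb).exists_subset_card_eq m
    refine ⟨|finsetDivDiff f T₁| + |finsetDivDiff f T₂|, fun S hS hSc => ?_⟩
    have mono : ∀ T T' : Finset ℝ, ↑T ⊆ Set.Icc a b → ↑T' ⊆ Set.Icc a b → T.card = m →
        T'.card = m → (∀ s ∈ T, ∀ t ∈ T', s < t) → finsetDivDiff f T ≤ finsetDivDiff f T' := by
      intro T T' hT hT' hc hc' hlt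
      have := le_finsetDivDiff_union_sub_union f (k := m) (lo := 0) (A := ∅) hc hc' (by simp)
        (by simp) (by simp) (disjoint_left.2 fun u hu hu' => (hlt u hu u hu').false)
        (fun s hs t ht U hU hUc => mul_nonneg (sub_nonneg.2 (hlt s hs t ht).le)
          (hf U (fun u hu => by
            have := hU hu
            simp only [empty_union, mem_union] at this
            exact this.elim (fun h => hT h) (fun h => hT' h)) hUc))
      simpa using this
    have hS' : ↑S ⊆ Set.Icc a b := hS.trans (Set.Icc_subset_Icc hac.le hdb.le)
    have h1 := mono T₁ S (fun u hu => ⟨(hT₁ hu).1.le, by linarith [(hT₁ hu).2]⟩) hS' hc₁ hSc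
      (fun s hs t ht => (hT₁ hs).2.trans_le (hS ht).1)
    have h2 := mono S T₂ hS' (fun u hu => ⟨by linarith [(hT₂ hu).1], (hT₂ hu).2.le⟩) hSc hc₂
      (fun s hs t ht => (hS hs).2.trans_lt (hT₂ ht).1)
    rw [abs_le]
    constructor
    · linarith [neg_abs_le (finsetDivDiff f T₁), abs_nonneg (finsetDivDiff f T₂)]
    · linarith [le_abs_self (finsetDivDiff f T₂), abs_nonneg (finsetDivDiff f T₁)]
  | of_succ k hk ih =>
    obtain ⟨c', hac', hc'c⟩ := exists_between hac
    obtain ⟨C, hC⟩ := ih hac' (hc'c.trans hcd)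
    obtain ⟨T, hT, hTc⟩ := (Set.Ioo_infinite hc'c).exists_subset_card_eq k
    refine ⟨|finsetDivDiff f T| + k * ((d - c') * C), fun S hS hSc => ?_⟩
    have hSI : ∀ u ∈ S, u ∈ Set.Icc c' d := fun u hu => ⟨hc'c.le.trans (hS hu).1, (hS hu).2⟩
    have hTI : ∀ u ∈ T, u ∈ Set.Icc c' d := fun u hu =>
      ⟨(hT hu).1.le, (hT hu).2.le.trans hcd.le⟩
    have key : ∀ s ∈ Set.Icc c' d, ∀ t ∈ Set.Icc c' d, ∀ U ⊆ S ∪ T, U.card = k + 1 →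
        -((d - c') * C) ≤ (t - s) * finsetDivDiff f U := by
      intro s hs t ht U hU hUc
      have h1 := hC U (fun u hu => (mem_union.1 (hU hu)).elim (hSI u) (hTI u)) hUc
      have h2 : |t - s| ≤ d - c' := abs_le.2 ⟨by linarith [hs.2, ht.1], by linarith [hs.1, ht.2]⟩
      have h3 := mul_le_mul h2 h1 (abs_nonneg _) ((abs_nonneg _).trans h2)
      rw [← abs_mul] at h3
      exact (abs_le.1 h3).1
    have hdis : Disjoint S T := disjoint_left.2 fun u hu hu' =>
      absurd (hT hu').2 (not_lt.2 (hS hu).1)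
    have h1 := le_finsetDivDiff_union_sub_union f (k := k) (A := ∅) hSc hTc (by simp) (by simp)
      (by simp) hdis (fun s hs t ht U hU => key s (hSI s hs) t (hTI t ht) U (by simpa using hU))
    have h2 := le_finsetDivDiff_union_sub_union f (k := k) (A := ∅) hTc hSc (by simp) (by simp)
      (by simp) hdis.symm (fun s hs t ht U hU => key s (hTI s hs) t (hSI t ht) U
        (by simpa [union_comm] using hU))
    simp only [empty_union] at h1 h2
    rw [abs_le]
    constructor
    · linarith [neg_abs_le (finsetDivDiff f T)]
    · linarith [le_abs_self (finsetDivDiff f T)]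

theorem exists_abs_eval_interpolate_le {f : ℝ → ℝ} {a b : ℝ} {m : ℕ}
    (hf : ∀ S : Finset ℝ, ↑S ⊆ Set.Icc a b → S.card = m + 1 → 0 ≤ finsetDivDiff f S)
    {k : ℕ} (hk : k ≤ m) {c d : ℝ} (hac : a < c) (hcd : c < d) (hdb : d < b) :
    ∃ C, ∀ S : Finset ℝ, ↑S ⊆ Set.Icc c d → S.card = k → ∀ t ∈ Set.Icc a b,
      |(Lagrange.interpolate S id f).eval t| ≤ C := by
  induction k with
  | zero =>
    refine ⟨0, fun S _ hS t _ => ?_⟩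
    rw [card_eq_zero] at hS
    simp [hS]
  | succ k ih =>
    obtain ⟨C, hC⟩ := ih (by omega)
    obtain ⟨K, hK⟩ := exists_abs_finsetDivDiff_le hf hk hac hcd hdb
    refine ⟨C + K * (b - a) ^ k, fun S hS hSc t ht => ?_⟩
    obtain ⟨y, R, hy, rfl, hR⟩ := card_eq_succ.1 hSc
    rw [eval_interpolate_insert f hy]
    have hRI : ↑R ⊆ Set.Icc c d := fun u hu => hS (mem_insert_of_mem hu)
    refine (abs_add_le _ _).trans (add_le_add (hC R hRI hR t ht) ?_)
    rw [abs_mul, abs_prod]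
    refine mul_le_mul (hK _ hS hSc) ?_ (prod_nonneg fun _ _ => abs_nonneg _)
      ((abs_nonneg _).trans (hK _ hS hSc))
    refine (prod_le_prod (fun _ _ => abs_nonneg _) fun z hz => ?_).trans_eq
      (by rw [prod_const, hR])
    have := hRI hz
    exact abs_le.2 ⟨by linarith [ht.1, this.2], by linarith [ht.2, this.1]⟩

theorem continuousOn_Ioo_of_finsetDivDiff_nonneg {f : ℝ → ℝ} {a b : ℝ} {m : ℕ} (hm : 2 ≤ m)
    (hf : ∀ S : Finset ℝ, ↑S ⊆ Set.Icc a b → S.card = m + 1 → 0 ≤ finsetDivDiff f S) :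
    ContinuousOn f (Set.Ioo a b) := by
  intro x hx
  obtain ⟨c, hac, hcx⟩ := exists_between hx.1
  obtain ⟨d, hxd, hdb⟩ := exists_between hx.2
  obtain ⟨C, hC⟩ := exists_abs_finsetDivDiff_le hf hm hac (hcx.trans hxd) hdb
  have hlip : LipschitzOnWith C.toNNReal f (Set.Icc c d) := by
    refine LipschitzOnWith.of_dist_le_mul fun u hu v hv => ?_
    rw [Real.dist_eq, Real.dist_eq]
    by_cases huv : u = v
    · simp [huv]
    have h1 := hC {u, v} (by simp [Set.insert_subset_iff, hu, hv]) (card_pair huv)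
    have h2 := finsetDivDiff_insert_sub_insert f (R := ∅) (x := u) (y := v) (by simp) (by simp) huv
    simp only [insert_empty_eq, finsetDivDiff_singleton] at h2
    rw [abs_sub_comm, h2, abs_mul, abs_sub_comm, mul_comm]
    exact mul_le_mul_of_nonneg_right (h1.trans (Real.le_coe_toNNReal C)) (abs_nonneg _)
  exact (hlip.continuousOn.continuousAt (Icc_mem_nhds hcx hxd)).continuousWithinAt

theorem prod_sub_nonneg_of_even_card {S : Finset ℝ} (hS : Even S.card) {t : ℝ}
    (ht : (∀ y ∈ S, t ≤ y) ∨ ∀ y ∈ S, y ≤ t) : 0 ≤ ∏ y ∈ S, (t - y) := by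
  rcases ht with ht | ht
  · have h := prod_neg (s := S) (f := fun y => y - t)
    simp only [neg_sub, hS.neg_one_pow, one_mul] at h
    exact h ▸ prod_nonneg fun y hy => sub_nonneg.2 (ht y hy)
  · exact prod_nonneg fun y hy => sub_nonneg.2 (ht y hy)

theorem exists_abs_le_of_finsetDivDiff_nonneg {f : ℝ → ℝ} {a b : ℝ} {m : ℕ} (hm : 2 ≤ m)
    (hme : Even m) (hab : a < b)
    (hf : ∀ S : Finset ℝ, ↑S ⊆ Set.Icc a b → S.card = m + 1 → 0 ≤ finsetDivDiff f S) :
    ∃ M, ∀ t ∈ Set.Icc a b, |f t| ≤ M := by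
  obtain ⟨c, hac, hcb⟩ := exists_between hab
  obtain ⟨d, hcd, hdb⟩ := exists_between hcb
  have hcont := continuousOn_Ioo_of_finsetDivDiff_nonneg hm hf
  obtain ⟨M₁, hM₁⟩ := (isCompact_Icc (a := c) (b := d)).exists_bound_of_continuousOn
    (hcont.mono fun u hu => ⟨hac.trans_le hu.1, hu.2.trans_lt hdb⟩)
  have hpoly : ∀ p : Polynomial ℝ, ∃ M, ∀ t ∈ Set.Icc a b, |p.eval t| ≤ M := fun p =>
    isCompact_Icc.exists_bound_of_continuousOn p.continuous.continuousOn
  obtain ⟨S, hS, hSc⟩ := (Set.Ioo_infinite hcd).exists_subset_card_eq m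
  obtain ⟨R, hR, hRc⟩ := (Set.Ioo_infinite hcd).exists_subset_card_eq (m - 2)
  have haR : a ∉ R := fun h => (hac.trans (hR h).1).false
  have hbR : b ∉ R := fun h => ((hR h).2.trans hdb).false
  have habR : a ∉ insert b R := by simp [hab.ne, haR]
  obtain ⟨M₂, hM₂⟩ := hpoly (Lagrange.interpolate S id f)
  obtain ⟨M₃, hM₃⟩ := hpoly (Lagrange.interpolate (insert a (insert b R)) id f)
  have hsub : ∀ T : Finset ℝ, ↑T ⊆ Set.Ioo c d → ↑T ⊆ Set.Icc a b := fun T hT u hu =>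
    ⟨hac.le.trans (hT hu).1.le, (hT hu).2.le.trans hdb.le⟩
  refine ⟨max M₁ (max M₂ M₃), fun t ht => ?_⟩
  by_cases htm : t ∈ Set.Icc c d
  · exact (hM₁ t htm).trans (le_max_left _ _)
  have hside : ∀ T : Finset ℝ, ↑T ⊆ Set.Ioo c d →
      t ∉ T ∧ ((∀ y ∈ T, t ≤ y) ∨ ∀ y ∈ T, y ≤ t) := by
    intro T hT
    refine ⟨fun h => htm (Set.Ioo_subset_Icc_self (hT h)), ?_⟩
    by_cases htc : c ≤ t
    · exact Or.inr fun y hy => by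
        have : d < t := lt_of_not_ge fun h => htm ⟨htc, h⟩
        exact ((hT hy).2.trans this).le
    · exact Or.inl fun y hy => ((not_le.1 htc).trans (hT hy).1).le
  have hlow : (Lagrange.interpolate S id f).eval t ≤ f t := by
    have h1 := sub_eval_interpolate f (hside S hS).1
    have h2 := hf (insert t S) (by
      rw [coe_insert]; exact Set.insert_subset ht (hsub S hS))
      (by rw [card_insert_of_notMem (hside S hS).1, hSc])
    have h3 := mul_nonneg h2 (prod_sub_nonneg_of_even_card (hSc ▸ hme) (hside S hS).2)
    linarith
  have hup : f t ≤ (Lagrange.interpolate (insert a (insert b R)) id f).eval t := by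
    by_cases hmem : t ∈ insert a (insert b R)
    · exact (Lagrange.eval_interpolate_at_node f Function.injective_id.injOn hmem).ge
    have h1 := sub_eval_interpolate f hmem
    have h2 := hf (insert t (insert a (insert b R))) (by
      simp only [coe_insert]
      exact Set.insert_subset ht (Set.insert_subset (Set.left_mem_Icc.2 hab.le)
        (Set.insert_subset (Set.right_mem_Icc.2 hab.le) (hsub R hR))))
      (by rw [card_insert_of_notMem hmem, card_insert_of_notMem habR,
            card_insert_of_notMem hbR, hRc]; omega)
    rw [prod_insert habR, prod_insert hbR] at h1
    have h3 := prod_sub_nonneg_of_even_card (t := t) (S := R)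
      (hRc ▸ (Nat.even_sub hm).2 (by simp [hme])) (hside R hR).2
    have h4 := mul_nonneg (mul_nonneg (sub_nonneg.2 ht.1) (sub_nonneg.2 ht.2)) (mul_nonneg h2 h3)
    nlinarith
  rw [abs_le]
  constructor
  · linarith [(abs_le.1 (hM₂ t ht)).1, le_max_left M₂ M₃, le_max_right M₁ (max M₂ M₃)]
  · linarith [(abs_le.1 (hM₃ t ht)).2, le_max_right M₂ M₃, le_max_right M₁ (max M₂ M₃)]

theorem disjoint_image_image_add {n : ℕ} {x : Fin n → ℝ} {ε : ℝ}
    (hne : ∀ i j, x i + ε ≠ x j) :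
    Disjoint (univ.image x) (univ.image fun i => x i + ε) := by
  simp only [disjoint_left, mem_image, mem_univ, true_and]
  rintro _ ⟨j, rfl⟩ ⟨i, h⟩
  exact hne i j h

theorem card_image_union_image_add {n : ℕ} {x : Fin n → ℝ} (hx : Function.Injective x) {ε : ℝ}
    (hne : ∀ i j, x i + ε ≠ x j) :
    (univ.image x ∪ univ.image fun i => x i + ε).card = 2 * n := by
  rw [card_union_of_disjoint (disjoint_image_image_add hne),
    card_image_of_injective _ hx,
    card_image_of_injective (f := fun i => x i + ε) _ ((add_left_injective ε).comp hx), card_univ,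
    Fintype.card_fin, two_mul]

theorem eval_interpolate_image_union_image_add_le {f : ℝ → ℝ} {a b : ℝ} {n : ℕ}
    (hf : ∀ S : Finset ℝ, ↑S ⊆ Set.Icc a b → S.card = 2 * n + 1 → 0 ≤ finsetDivDiff f S)
    {x : Fin n → ℝ} (hx : Function.Injective x) {ε : ℝ} (hε : 0 ≤ ε)
    (hne : ∀ i j, x i + ε ≠ x j)
    (hI : ↑(univ.image x ∪ univ.image fun i => x i + ε) ⊆ Set.Icc a b)
    {t : ℝ} (ht : t ∈ Set.Icc a b) (hgap : ∀ i, t ≤ x i ∨ x i + ε ≤ t) :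
    (Lagrange.interpolate (univ.image x ∪ univ.image fun i => x i + ε) id f).eval t ≤ f t := by
  by_cases hmem : t ∈ univ.image x ∪ univ.image fun i => x i + ε
  · exact (Lagrange.eval_interpolate_at_node f Function.injective_id.injOn hmem).le
  have h1 := sub_eval_interpolate f hmem
  have h2 := hf (insert t (univ.image x ∪ univ.image fun i => x i + ε))
    (by rw [coe_insert]; exact Set.insert_subset ht hI)
    (by rw [card_insert_of_notMem hmem, card_image_union_image_add hx hne])
  rw [prod_union (disjoint_image_image_add hne), prod_image hx.injOn,
    prod_image (g := fun i => x i + ε) ((add_left_injective ε).comp hx).injOn,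
    ← prod_mul_distrib] at h1
  have h3 : 0 ≤ ∏ i, (t - x i) * (t - (x i + ε)) := prod_nonneg fun i _ => by
    rcases hgap i with h | h
    · exact mul_nonneg_of_nonpos_of_nonpos (by linarith) (by linarith)
    · exact mul_nonneg (by linarith) (by linarith)
  linarith [mul_nonneg h2 h3]

end FinsetDivDiff

open Finset Filter Topology

open MeasureTheory in
/-- Proposition 1, first inequality (Gauss-type quadratures): a quadrature rule with
nodes in `(a, b)` which is exact on `Π_{2n−1}` underestimates the weighted integral
of every `(2n−1)`-convex function. -/
theorem gauss_quadrature_le_integral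
    (n : ℕ) (hn : 1 ≤ n) (a b : ℝ)
    (w : ℝ → ℝ) (hw_int : IntervalIntegrable w volume a b)
    (hw_nonneg : ∀ x ∈ Set.Icc a b, 0 ≤ w x)
    (x : Fin n → ℝ) (hx : StrictMono x) (hxI : ∀ i, x i ∈ Set.Ioo a b)
    (wt : Fin n → ℝ)
    (hexact : ∀ p : Polynomial ℝ, p.natDegree ≤ 2 * n - 1 →
      ∑ i, wt i * p.eval (x i) = ∫ t in a..b, p.eval t * w t)
    (f : ℝ → ℝ) (hf : NConvexOn (2 * n - 1) (Set.Icc a b) f) :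
    ∑ i, wt i * f (x i) ≤ ∫ t in a..b, f t * w t := by
  set m := 2 * n with hm
  have hm2 : 2 ≤ m := by omega
  have hf' : ∀ S : Finset ℝ, ↑S ⊆ Set.Icc a b → S.card = m + 1 → 0 ≤ finsetDivDiff f S :=
    fun S hS hSc => hf.finsetDivDiff_nonneg (by omega) hS
  obtain ⟨c, hac, hc⟩ := exists_between (hxI ⟨0, hn⟩).1
  obtain ⟨d, hd, hdb⟩ := exists_between (hxI ⟨n - 1, by omega⟩).2
  have hcx : ∀ i, c < x i := fun i => hc.trans_le (hx.monotone (Nat.zero_le i.1))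
  have hxd : ∀ i, x i < d := fun i =>
    (hx.monotone (show i ≤ ⟨n - 1, by omega⟩ from Nat.le_sub_one_of_lt i.2)).trans_lt hd
  have hcd : c < d := (hcx ⟨0, hn⟩).trans (hxd ⟨0, hn⟩)
  have hab : a < b := (hac.trans hcd).trans hdb
  obtain ⟨M, hM⟩ := exists_abs_le_of_finsetDivDiff_nonneg hm2 ⟨n, by omega⟩ hab hf'
  obtain ⟨C, hC⟩ := exists_abs_eval_interpolate_le hf' le_rfl hac hcd hdb
  have hfm : AEStronglyMeasurable f (volume.restrict (Set.uIoc a b)) := by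
    rw [Set.uIoc_of_le hab.le, ← Measure.restrict_congr_set Ioo_ae_eq_Ioc]
    exact (continuousOn_Ioo_of_finsetDivDiff_nonneg hm2 hf').aestronglyMeasurable
      measurableSet_Ioo
  have hwm : AEStronglyMeasurable w (volume.restrict (Set.uIoc a b)) := by
    rw [Set.uIoc_of_le hab.le]
    exact hw_int.aestronglyMeasurable
  have hmem : ∀ t ∈ Set.uIoc a b, t ∈ Set.Icc a b := fun t ht => by
    rw [Set.uIoc_of_le hab.le] at ht
    exact Set.Ioc_subset_Icc_self ht
  have hfw : IntervalIntegrable (fun t => f t * w t) volume a b := by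
    refine (hw_int.const_mul M).mono_fun (hfm.mul hwm) ?_
    filter_upwards [ae_restrict_mem measurableSet_uIoc] with t ht
    rw [norm_mul, norm_mul]
    exact mul_le_mul_of_nonneg_right ((hM t (hmem t ht)).trans (le_abs_self M)) (norm_nonneg _)
  let S : ℝ → Finset ℝ := fun ε => univ.image x ∪ univ.image fun i => x i + ε
  let p : ℝ → Polynomial ℝ := fun ε => Lagrange.interpolate (S ε) id f
  have hev : ∀ᶠ ε in 𝓝[>] (0 : ℝ), 0 < ε ∧ (∀ i, x i + ε < d) ∧ ∀ i j, x i + ε ≠ x j := by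
    refine (eventually_mem_nhdsWithin).and ((Filter.eventually_all.2 fun i => ?_).and
      (Filter.eventually_all.2 fun i => Filter.eventually_all.2 fun j => ?_))
    · filter_upwards [Ioo_mem_nhdsGT (sub_pos.2 (hxd i))] with ε hε
      linarith [hε.2]
    · rcases le_or_gt (x j) (x i) with h | h
      · filter_upwards [self_mem_nhdsWithin] with ε hε
        have : 0 < ε := hε
        exact fun h' => by linarith
      · filter_upwards [Ioo_mem_nhdsGT (sub_pos.2 h)] with ε hε
        exact fun h' => by linarith [hε.2]
  have hSI : ∀ ε, 0 < ε → (∀ i, x i + ε < d) → ↑(S ε) ⊆ Set.Icc c d := by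
    intro ε hε hεd y hy
    simp only [S, mem_coe, mem_union, mem_image, mem_univ, true_and] at hy
    rcases hy with ⟨i, rfl⟩ | ⟨i, rfl⟩
    · exact ⟨(hcx i).le, (hxd i).le⟩
    · exact ⟨by linarith [hcx i], (hεd i).le⟩
  have hSc : ∀ ε, (∀ i j, x i + ε ≠ x j) → (S ε).card = m := fun ε hne =>
    card_image_union_image_add hx.injective hne
  have hlim : Tendsto (fun ε => ∫ t in a..b, max ((p ε).eval t - f t) 0 * w t) (𝓝[>] 0)
      (𝓝 (∫ t in a..b, (0 : ℝ))) := by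
    refine intervalIntegral.tendsto_integral_filter_of_dominated_convergence
      (fun t => (C + M) * w t) (Filter.Eventually.of_forall fun ε => ?_) ?_
      (hw_int.const_mul _) (Filter.Eventually.of_forall fun t ht => ?_)
    · exact (((p ε).continuous.aestronglyMeasurable.sub hfm).sup
        aestronglyMeasurable_const).mul hwm
    · filter_upwards [hev] with ε ⟨hε, hεd, hne⟩
      refine Filter.Eventually.of_forall fun t ht => ?_
      have hw := hw_nonneg t (hmem t ht)
      have h1 := abs_le.1 (hC (S ε) (hSI ε hε hεd) (hSc ε hne) t (hmem t ht))
      have h2 := abs_le.1 (hM t (hmem t ht))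
      rw [Real.norm_of_nonneg (mul_nonneg (le_max_right _ _) hw)]
      exact mul_le_mul_of_nonneg_right
        (max_le (by linarith [h1.2, h2.1]) (by linarith [h1.1, h1.2, h2.1, h2.2])) hw
    · have hgap : ∀ᶠ ε in 𝓝[>] (0 : ℝ), ∀ i, t ≤ x i ∨ x i + ε ≤ t := by
        refine Filter.eventually_all.2 fun i => ?_
        rcases le_or_gt t (x i) with h | h
        · exact Filter.Eventually.of_forall fun _ => Or.inl h
        · filter_upwards [Ioo_mem_nhdsGT (sub_pos.2 h)] with ε hε
          exact Or.inr (by linarith [hε.2])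
      refine tendsto_const_nhds.congr' ?_
      filter_upwards [hev, hgap] with ε ⟨hε, hεd, hne⟩ hg
      rw [max_eq_right, zero_mul]
      exact sub_nonpos.2 (eval_interpolate_image_union_image_add_le hf' hx.injective hε.le hne
        ((hSI ε hε hεd).trans (Set.Icc_subset_Icc hac.le hdb.le)) (hmem t ht) hg)
  have hle : ∀ᶠ ε in 𝓝[>] (0 : ℝ), ∑ i, wt i * f (x i) ≤
      (∫ t in a..b, f t * w t) + ∫ t in a..b, max ((p ε).eval t - f t) 0 * w t := by
    filter_upwards [hev] with ε ⟨hε, hεd, hne⟩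
    have hint : IntervalIntegrable (fun t => (p ε).eval t * w t) volume a b :=
      hw_int.continuousOn_mul (p ε).continuous.continuousOn
    have hmax : IntervalIntegrable (fun t => max ((p ε).eval t - f t) 0 * w t) volume a b := by
      refine (hint.sub hfw).mono_fun ((((p ε).continuous.aestronglyMeasurable.sub hfm).sup
        aestronglyMeasurable_const).mul hwm) (Filter.Eventually.of_forall fun t => ?_)
      simp only [← sub_mul]
      rw [norm_mul, norm_mul]
      refine mul_le_mul_of_nonneg_right ?_ (norm_nonneg _)
      rw [Real.norm_of_nonneg (le_max_right _ _)]
      exact max_le (le_abs_self _) (norm_nonneg _)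
    have hdeg : (p ε).natDegree ≤ m - 1 := by
      rw [← hSc ε hne]
      exact Polynomial.natDegree_le_of_degree_le
        (Lagrange.degree_interpolate_le f Function.injective_id.injOn)
    have hval : ∀ i, (p ε).eval (x i) = f (x i) := fun i =>
      Lagrange.eval_interpolate_at_node f Function.injective_id.injOn (by simp [S])
    have hex := hexact (p ε) hdeg
    simp only [hval] at hex
    rw [hex, ← intervalIntegral.integral_add hfw hmax]
    refine intervalIntegral.integral_mono_on hab.le hint (hfw.add hmax) fun t ht => ?_
    rw [← add_mul]
    exact mul_le_mul_of_nonneg_right (by linarith [le_max_left ((p ε).eval t - f t) 0])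
      (hw_nonneg t ht)
  rw [intervalIntegral.integral_zero] at hlim
  simpa using ge_of_tendsto (hlim.const_add (∫ t in a..b, f t * w t)) hle
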